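/- Let E ⊆ ℂ and let h : Δ × E → ℂ be a holomorphic motion of E parametrized by the open unit disk Δ with base point 0. Then h is jointly continuous, i.e., h is continuous as a map from Δ × E (with the subspace topology from ℂ × ℂ) to ℂ. -/

import Mathlib

/-- A holomorphic motion of a set `E ⊆ ℂ` parametrized by the open unit disk
with base point `0`. -/
def IsHolomorphicMotion (E : Set ℂ) (h : ℂ → ℂ → ℂ) : Prop :=
  (∀ z ∈ E, h 0 z = z) ∧
  (∀ c ∈ Metric.ball (0 : ℂ) 1, Set.InjOn (fun z => h c z) E) ∧
  (∀ z ∈ E, DifferentiableOn ℂ (fun c => h c z) (Metric.ball (0 : ℂ) 1))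

open Metric Set Filter Topology

/-- A nonvanishing holomorphic function on a disk has a holomorphic logarithm with prescribed
value at the center. -/
theorem exists_differentiableOn_exp_eq {f : ℂ → ℂ} {c : ℂ} {R : ℝ}
    (hf : DifferentiableOn ℂ f (ball c R)) (hf0 : ∀ z ∈ ball c R, f z ≠ 0) {a : ℂ}
    (ha : Complex.exp a = f c) :
    ∃ L : ℂ → ℂ, DifferentiableOn ℂ L (ball c R) ∧ L c = a ∧
      ∀ z ∈ ball c R, Complex.exp (L z) = f z := by
  rcases le_or_gt R 0 with hR | hR
  · simp only [ball_eq_empty.2 hR]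
    exact ⟨fun _ => a, by simp⟩
  obtain ⟨L, hLc, hL⟩ := ((hf.deriv isOpen_ball).div hf hf0).isExactOn_ball.with_val_at c a
  refine ⟨L, fun z hz => (hL z hz).differentiableAt.differentiableWithinAt, hLc, ?_⟩
  have hder : ∀ z ∈ ball c R,
      HasDerivAt (fun z => f z * Complex.exp (-L z)) 0 z := by
    intro z hz
    have h1 := (hf.differentiableAt (isOpen_ball.mem_nhds hz)).hasDerivAt
    have h2 := h1.mul (hL z hz).neg.cexp
    refine h2.congr_deriv ?_
    have := hf0 z hz
    simp only [Pi.div_apply]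
    field_simp
    ring
  intro z hz
  have hc := (convex_ball c R).norm_image_sub_le_of_norm_hasDerivWithin_le (C := 0)
    (fun x hx => (hder x hx).hasDerivWithinAt) (by simp) (mem_ball_self hR) hz
  have hE : f z * Complex.exp (-L z) = f c * Complex.exp (-L c) := by
    simpa [sub_eq_zero] using hc
  rw [hLc, ← ha, ← Complex.exp_add, add_neg_cancel, Complex.exp_zero, Complex.exp_neg] at hE
  field_simp at hE
  exact hE.symm

/-- **Bloch's theorem**, in the form of a derivative estimate: if the image of a disk contains no
disk of radius `δ`, then the derivative at the center is controlled. -/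
theorem norm_deriv_mul_le_of_image_avoids {g : ℂ → ℂ} {a : ℂ} {R δ : ℝ} (hR : 0 < R) (hδ : 0 < δ)
    (hg : DifferentiableOn ℂ g (ball a R))
    (hav : ∀ w : ℂ, ∃ v ∈ ball w δ, v ∉ g '' ball a R) :
    ‖deriv g a‖ * R ≤ 48 * δ := by
  by_contra! hlt
  have hd : 0 < ‖deriv g a‖ := by
    by_contra! h
    nlinarith
  have hdg := hg.deriv isOpen_ball
  obtain ⟨r, hr1, hrR⟩ : ∃ r, 48 * δ / ‖deriv g a‖ < r ∧ r < R :=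
    exists_between (by rwa [div_lt_iff₀' hd])
  have hr0 : 0 < r := lt_trans (by positivity) hr1
  have hr : 48 * δ < ‖deriv g a‖ * r := by rwa [div_lt_iff₀' hd] at hr1
  obtain ⟨p, hp, hmax⟩ := (isCompact_closedBall a r).exists_isMaxOn
    (f := fun z => ‖deriv g z‖ * (r - dist z a)) ⟨a, mem_closedBall_self hr0.le⟩
    ((hdg.continuousOn.mono (closedBall_subset_ball hrR)).norm.mul (by fun_prop))
  have hM : 48 * δ < ‖deriv g p‖ * (r - dist p a) := by
    have := hmax (mem_closedBall_self hr0.le)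
    simp only [mem_ofPred_eq, dist_self, sub_zero] at this
    linarith
  have hpr : dist p a < r := by
    by_contra! h
    nlinarith [norm_nonneg (deriv g p)]
  set D := ‖deriv g p‖ with hD
  have hD0 : 0 < D := by
    by_contra! h
    nlinarith
  set t := (r - dist p a) / 2 with ht
  have ht0 : 0 < t := by rw [ht]; linarith
  have hsub : ball p t ⊆ ball a R := by
    refine ball_subset_ball' ?_
    linarith
  have h2 : ∀ z ∈ ball p t, ‖deriv g z‖ ≤ 2 * D := by
    intro z hz
    rw [mem_ball] at hz
    have htri := dist_triangle z p a
    have hza : z ∈ closedBall a r := by rw [mem_closedBall]; linarith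
    have := hmax hza
    simp only [mem_ofPred_eq] at this
    have h3 : ‖deriv g z‖ * t ≤ ‖deriv g z‖ * (r - dist z a) := by
      gcongr; linarith
    have h4 : ‖deriv g z‖ * t ≤ 2 * D * t := by
      calc _ ≤ D * (r - dist p a) := h3.trans this
        _ = _ := by rw [ht]; ring
    exact le_of_mul_le_mul_right h4 ht0
  have hmaps : MapsTo (deriv g) (ball p t) (closedBall (deriv g p) (3 * D)) := by
    intro z hz
    rw [mem_closedBall, dist_eq_norm]
    calc _ ≤ ‖deriv g z‖ + ‖deriv g p‖ := norm_sub_le _ _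
      _ ≤ _ := by linarith [h2 z hz]
  have hsub6 : closedBall p (t / 6) ⊆ ball p t := closedBall_subset_ball (by linarith)
  have h5 : ∀ z ∈ closedBall p (t / 6), ‖deriv g z - deriv g p‖ ≤ D / 2 := by
    intro z hz
    have := Complex.dist_le_div_mul_dist_of_mapsTo_ball (hdg.mono hsub) hmaps (hsub6 hz)
    rw [mem_closedBall] at hz
    rw [← dist_eq_norm]
    calc _ ≤ 3 * D / t * dist z p := this
      _ ≤ 3 * D / t * (t / 6) := by gcongr
      _ = D / 2 := by field_simp; norm_num
  have hgd : ∀ z ∈ ball p t, HasDerivAt g (deriv g z) z := fun z hz =>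
    (hg.differentiableAt (isOpen_ball.mem_nhds (hsub hz))).hasDerivAt
  have h6 : ∀ z ∈ closedBall p (t / 6), ‖g z - g p - deriv g p * (z - p)‖ ≤ D / 2 * ‖z - p‖ := by
    intro z hz
    have := (convex_closedBall p (t / 6)).norm_image_sub_le_of_norm_hasDerivWithin_le
      (f := fun z => g z - deriv g p * z) (f' := fun z => deriv g z - deriv g p * 1) (C := D / 2)
      (fun x hx => ((hgd x (hsub6 hx)).sub
        ((hasDerivAt_id x).const_mul (deriv g p))).hasDerivWithinAt)
      (fun x hx => by simpa using h5 x hx) (mem_closedBall_self (by positivity)) hz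
    rwa [sub_sub_sub_comm, ← mul_sub] at this
  have h7 : ∀ z ∈ closedBall p (t / 6), D / 2 * ‖z - p‖ ≤ ‖g z - g p‖ := by
    intro z hz
    have h8 := norm_sub_norm_le (deriv g p * (z - p)) (g z - g p)
    have := h6 z hz
    rw [norm_mul, norm_sub_rev (deriv g p * (z - p))] at h8
    linarith
  have hdc : DiffContOnCl ℂ g (ball p (t / 6)) :=
    (hg.mono (hsub6.trans hsub)).diffContOnCl_ball (Subset.refl _)
  have h8 := hdc.ball_subset_image_closedBall (ε := D / 2 * (t / 6)) (by positivity)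
    (fun z hz => by
      have := h7 z (sphere_subset_closedBall hz)
      rw [mem_sphere, dist_eq_norm] at hz
      rwa [hz] at this)
    (by
      have : ∀ᶠ z in 𝓝[≠] p, g z ≠ g p := by
        filter_upwards [self_mem_nhdsWithin,
          mem_nhdsWithin_of_mem_nhds (closedBall_mem_nhds p (by positivity : 0 < t / 6))]
          with z hz hz'
        intro h
        have h9 := h7 z hz'
        have : 0 < ‖z - p‖ := norm_pos_iff.2 (sub_ne_zero.2 hz)
        rw [h, sub_self, norm_zero] at h9
        nlinarith
      exact this.frequently.filter_mono nhdsWithin_le_nhds)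
  obtain ⟨v, hv, hv'⟩ := hav (g p)
  refine hv' (image_mono (hsub6.trans hsub) (h8 (ball_subset_ball ?_ hv)))
  have : D * (r - dist p a) = D * (2 * t) := by rw [ht]; ring
  rw [this] at hM
  linarith

theorem Real.exists_cosh_eq_two_mul_int_sub_one (s : ℝ) :
    ∃ x : ℝ, |x - s| ≤ 5 ∧ ∃ n : ℤ, Real.cosh x = 2 * n - 1 := by
  wlog hs : 0 ≤ s generalizing s
  · obtain ⟨x, hx, n, hn⟩ := this (-s) (by linarith)
    refine ⟨-x, ?_, n, by rwa [Real.cosh_neg]⟩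
    rw [← abs_neg]
    convert hx using 2
    ring
  have h5 : (3 : ℝ) ≤ Real.cosh 5 := by
    rw [Real.cosh_eq]
    linarith [Real.add_one_le_exp (5 : ℝ), Real.exp_pos (-5)]
  have hgap : Real.cosh s + 2 ≤ Real.cosh (s + 5) := by
    rw [Real.cosh_add]
    have h1 : 0 ≤ Real.sinh s * Real.sinh 5 :=
      mul_nonneg (Real.sinh_nonneg_iff.2 hs) (Real.sinh_nonneg_iff.2 (by norm_num))
    nlinarith [Real.one_le_cosh s]
  have hc1 := Int.le_ceil ((Real.cosh s + 1) / 2)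
  have hc2 := Int.ceil_lt_add_one ((Real.cosh s + 1) / 2)
  obtain ⟨x, hx, hxn⟩ := intermediate_value_Icc (show s ≤ s + 5 by linarith)
    Real.continuous_cosh.continuousOn
    (show (2 * ⌈(Real.cosh s + 1) / 2⌉ - 1 : ℝ) ∈ Icc (Real.cosh s) (Real.cosh (s + 5)) from
      ⟨by linarith, by linarith⟩)
  exact ⟨x, abs_le.2 ⟨by linarith [hx.1], by linarith [hx.2]⟩, _, hxn⟩

theorem Complex.exists_mem_ball_cosh_eq_two_mul_int_sub_one (w : ℂ) :
    ∃ v ∈ ball w 9, ∃ n : ℤ, Complex.cosh v = 2 * n - 1 := by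
  obtain ⟨x, hx, n, hn⟩ := Real.exists_cosh_eq_two_mul_int_sub_one w.re
  set k : ℤ := round (w.im / (2 * Real.pi)) with hk
  have hpi := Real.pi_pos
  have hround : |2 * Real.pi * k - w.im| ≤ Real.pi := by
    have h1 := abs_sub_round (w.im / (2 * Real.pi))
    rw [← hk, abs_sub_comm] at h1
    have h2 : 2 * Real.pi * k - w.im = 2 * Real.pi * (k - w.im / (2 * Real.pi)) := by
      field_simp
    rw [h2, abs_mul, abs_of_pos (by positivity)]
    nlinarith
  refine ⟨x + k * (2 * Real.pi * Complex.I), ?_, n, ?_⟩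
  · rw [mem_ball, dist_eq_norm]
    have h3 := Complex.norm_le_abs_re_add_abs_im (x + k * (2 * Real.pi * Complex.I) - w)
    have hre : (x + k * (2 * Real.pi * Complex.I) - w).re = x - w.re := by simp
    have him : (x + k * (2 * Real.pi * Complex.I) - w).im = 2 * Real.pi * k - w.im := by
      simp [mul_comm]
    rw [hre, him] at h3
    linarith [Real.pi_lt_four]
  · rw [Complex.cosh_periodic.int_mul k x]
    exact_mod_cast hn

theorem Complex.norm_log_le (z : ℂ) : ‖Complex.log z‖ ≤ |Real.log ‖z‖| + Real.pi := by
  refine (Complex.norm_le_abs_re_add_abs_im _).trans ?_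
  rw [Complex.log_re, Complex.log_im]
  gcongr
  exact Complex.abs_arg_le_pi z

theorem exists_differentiableOn_sq_eq {f : ℂ → ℂ} {c : ℂ} {R : ℝ} (hR : 0 < R)
    (hf : DifferentiableOn ℂ f (ball c R)) (hf0 : ∀ z ∈ ball c R, f z ≠ 0) :
    ∃ A : ℂ → ℂ, DifferentiableOn ℂ A (ball c R) ∧ ∀ z ∈ ball c R, A z ^ 2 = f z := by
  obtain ⟨L, hL, -, hLf⟩ := exists_differentiableOn_exp_eq hf hf0
    (Complex.exp_log (hf0 c (mem_ball_self hR)))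
  refine ⟨fun z => Complex.exp (L z / 2), by fun_prop, fun z hz => ?_⟩
  rw [← hLf z hz, ← Complex.exp_nat_mul]
  congr 1
  push_cast
  ring

/-- A holomorphic function `F` on the unit disk omitting `0` and `1` can be written as
`(cosh u + 1) / 2`, with control of `u` at the center. -/
theorem exists_differentiableOn_cosh_eq {F : ℂ → ℂ} (hF : DifferentiableOn ℂ F (ball 0 1))
    (hF0 : ∀ z ∈ ball (0 : ℂ) 1, F z ≠ 0) (hF1 : ∀ z ∈ ball (0 : ℂ) 1, F z ≠ 1)
    (hF_le : ‖F 0‖ ≤ 1) :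
    ∃ u : ℂ → ℂ, DifferentiableOn ℂ u (ball 0 1) ∧ ‖u 0‖ ≤ 12 ∧
      ∀ z ∈ ball (0 : ℂ) 1, Complex.cosh (u z) = 2 * F z - 1 := by
  have h0 : (0 : ℂ) ∈ ball (0 : ℂ) 1 := mem_ball_self one_pos
  obtain ⟨A, hA, hAF⟩ := exists_differentiableOn_sq_eq one_pos hF hF0
  obtain ⟨B, hB, hBF⟩ := exists_differentiableOn_sq_eq one_pos (hF.sub_const 1)
    (fun z hz => sub_ne_zero.2 (hF1 z hz))
  have hAB : ∀ z ∈ ball (0 : ℂ) 1, (A z - B z) * (A z + B z) = 1 := by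
    intro z hz
    linear_combination hAF z hz - hBF z hz
  have hG0 : ∀ z ∈ ball (0 : ℂ) 1, A z - B z ≠ 0 := fun z hz => left_ne_zero_of_mul_eq_one (hAB z hz)
  obtain ⟨g, hg, hg0, hgG⟩ := exists_differentiableOn_exp_eq (hA.fun_sub hB) hG0
    (Complex.exp_log (hG0 0 h0))
  refine ⟨fun z => 2 * g z, by fun_prop, ?_, fun z hz => ?_⟩
  · have hA1 : ‖A 0‖ ≤ 1 := by
      have := congrArg norm (hAF 0 h0)
      rw [norm_pow] at this
      nlinarith
    have hB1 : ‖B 0‖ ≤ 2 := by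
      have := congrArg norm (hBF 0 h0)
      rw [norm_pow] at this
      have h1 := norm_sub_le (F 0) 1
      rw [norm_one] at h1
      nlinarith
    have hG3 : ‖A 0 - B 0‖ ≤ 3 := (norm_sub_le _ _).trans (by linarith)
    have hG3' : ‖A 0 - B 0‖⁻¹ ≤ 3 := by
      rw [← norm_inv, inv_eq_of_mul_eq_one_right (hAB 0 h0)]
      exact (norm_add_le _ _).trans (by linarith)
    have hpos : 0 < ‖A 0 - B 0‖ := norm_pos_iff.2 (hG0 0 h0)
    have hlog : |Real.log ‖A 0 - B 0‖| ≤ 2 :=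
      abs_le.2 ⟨by linarith [Real.one_sub_inv_le_log_of_pos hpos],
        by linarith [Real.log_le_sub_one_of_pos hpos]⟩
    have := Complex.norm_log_le (A 0 - B 0)
    rw [norm_mul, hg0, Complex.norm_ofNat]
    linarith [Real.pi_lt_four]
  · have h1 : Complex.exp (2 * g z) = (A z - B z) ^ 2 := by
      rw [← hgG z hz, ← Complex.exp_nat_mul]
      norm_cast
    have h2 : Complex.exp (-(2 * g z)) = (A z + B z) ^ 2 := by
      rw [Complex.exp_neg, h1]
      refine inv_eq_of_mul_eq_one_right ?_
      rw [← mul_pow, hAB z hz, one_pow]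
    rw [Complex.cosh, h1, h2]
    linear_combination hAF z hz + hBF z hz

theorem norm_le_of_omits_int {F : ℂ → ℂ} (hF : DifferentiableOn ℂ F (ball 0 1))
    (hFn : ∀ z ∈ ball (0 : ℂ) 1, ∀ n : ℤ, F z ≠ n) (hF_le : ‖F 0‖ ≤ 1) {r : ℝ} (hr : r < 1)
    {z : ℂ} (hz : ‖z‖ ≤ r) :
    ‖F z‖ ≤ Real.exp (12 + 432 / (1 - r)) + 1 := by
  obtain ⟨u, hu, hu0, huF⟩ := exists_differentiableOn_cosh_eq hF
    (fun z hz => by simpa using hFn z hz 0) (fun z hz => by simpa using hFn z hz 1) hF_le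
  have hr1 : 0 < 1 - r := by linarith
  have hsub : closedBall (0 : ℂ) r ⊆ ball 0 1 := closedBall_subset_ball hr
  have hder : ∀ a ∈ closedBall (0 : ℂ) r, ‖deriv u a‖ ≤ 432 / (1 - r) := by
    intro a ha
    have hball : ball a (1 - r) ⊆ ball 0 1 := by
      refine ball_subset_ball' ?_
      rw [mem_closedBall] at ha
      linarith
    rw [le_div_iff₀ hr1]
    refine (norm_deriv_mul_le_of_image_avoids hr1 (by norm_num : (0 : ℝ) < 9) (hu.mono hball)
      fun w => ?_).trans_eq (by norm_num)
    obtain ⟨v, hv, n, hn⟩ := Complex.exists_mem_ball_cosh_eq_two_mul_int_sub_one w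
    refine ⟨v, hv, ?_⟩
    rintro ⟨x, hx, rfl⟩
    refine hFn x (hball hx) n ?_
    have := huF x (hball hx)
    linear_combination (hn - this) / 2
  have hz' : z ∈ closedBall (0 : ℂ) r := mem_closedBall_zero_iff.2 hz
  have hr0 : 0 ≤ r := (norm_nonneg z).trans hz
  have hz1 := hsub hz'
  have hlip := (convex_closedBall (0 : ℂ) r).norm_image_sub_le_of_norm_deriv_le
    (fun x hx => hu.differentiableAt (isOpen_ball.mem_nhds (hsub hx))) hder
    (mem_closedBall_self hr0) hz'
  have huz : ‖u z‖ ≤ 12 + 432 / (1 - r) := by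
    have h1 := norm_sub_norm_le (u z) (u 0)
    rw [sub_zero] at hlip
    have h2 : 432 / (1 - r) * ‖z‖ ≤ 432 / (1 - r) := mul_le_of_le_one_right (by positivity) (by linarith)
    linarith
  have hFz : F z = (Complex.exp (u z) + Complex.exp (-u z) + 2) / 4 := by
    have := huF z hz1
    rw [Complex.cosh] at this
    linear_combination -this / 2
  have h1 := (Complex.norm_exp_le_exp_norm (u z)).trans (Real.exp_le_exp.2 huz)
  have h2 := (Complex.norm_exp_le_exp_norm (-u z)).trans
    (Real.exp_le_exp.2 ((norm_neg (u z)).trans_le huz))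
  rw [hFz, norm_div, Complex.norm_ofNat]
  have h3 := norm_add₃_le (a := Complex.exp (u z)) (b := Complex.exp (-u z)) (c := 2)
  rw [Complex.norm_ofNat] at h3
  rw [div_le_iff₀ (by norm_num)]
  linarith [Real.exp_pos (12 + 432 / (1 - r))]

/-- **Schottky's theorem**, for functions small at the center. -/
theorem exists_norm_le_of_omits_zero_one {r : ℝ} (hr : r < 1) :
    ∃ M : ℝ, ∀ f : ℂ → ℂ, DifferentiableOn ℂ f (ball 0 1) → (∀ z ∈ ball (0 : ℂ) 1, f z ≠ 0) →
      (∀ z ∈ ball (0 : ℂ) 1, f z ≠ 1) → ‖f 0‖ ≤ 1 / 2 → ∀ z : ℂ, ‖z‖ ≤ r → ‖f z‖ ≤ M := by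
  refine ⟨1 + Real.exp (2 * Real.pi * (Real.exp (12 + 432 / (1 - r)) + 1)), ?_⟩
  intro f hf hf0 hf1 hle z hz
  have h0 : (0 : ℂ) ∈ ball (0 : ℂ) 1 := mem_ball_self one_pos
  have hne : ∀ z ∈ ball (0 : ℂ) 1, 1 - f z ≠ 0 := fun z hz => sub_ne_zero.2 (hf1 z hz).symm
  obtain ⟨L, hL, hL0, hLf⟩ := exists_differentiableOn_exp_eq (hf.const_sub 1) hne
    (Complex.exp_log (hne 0 h0))
  have hpi := Real.pi_pos
  have hnorm : ‖(2 * Real.pi * Complex.I : ℂ)‖ = 2 * Real.pi := by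
    simp [abs_of_pos hpi]
  have hF_le : ‖L 0 / (2 * Real.pi * Complex.I)‖ ≤ 1 := by
    rw [norm_div, hnorm, div_le_one (by positivity), hL0]
    have hpos : 0 < ‖1 - f 0‖ := norm_pos_iff.2 (hne 0 h0)
    have h1 := norm_sub_le 1 (f 0)
    have h2 := norm_sub_norm_le 1 (f 0)
    rw [norm_one] at h1 h2
    have h3 : ‖1 - f 0‖⁻¹ ≤ 2 := inv_le_of_inv_le₀ (by norm_num) (by linarith)
    have hlog : |Real.log ‖1 - f 0‖| ≤ 1 :=
      abs_le.2 ⟨by linarith [Real.one_sub_inv_le_log_of_pos hpos],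
        by linarith [Real.log_le_sub_one_of_pos hpos]⟩
    linarith [Complex.norm_log_le (1 - f 0), Real.pi_gt_three]
  have hF := norm_le_of_omits_int (F := fun z => L z / (2 * Real.pi * Complex.I))
    (hL.div_const _) (fun z hz n hn => ?_) hF_le hr hz
  · rw [norm_div, hnorm, div_le_iff₀' (by positivity)] at hF
    have h1 : f z = 1 - Complex.exp (L z) := by
      rw [hLf z (closedBall_subset_ball hr (mem_closedBall_zero_iff.2 hz))]
      ring
    rw [h1]
    refine (norm_sub_le _ _).trans ?_
    rw [norm_one]
    gcongr
    exact (Complex.norm_exp_le_exp_norm _).trans (Real.exp_le_exp.2 hF)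
  · rw [div_eq_iff Complex.two_pi_I_ne_zero] at hn
    have h1 := hLf z hz
    rw [hn, Complex.exp_int_mul_two_pi_mul_I] at h1
    exact hf0 z hz (by linear_combination h1)

/-- Harnack's inequality for the logarithm of a bounded nonvanishing holomorphic function. -/
theorem norm_le_of_nonvanishing_of_norm_le {f : ℂ → ℂ} {R M : ℝ}
    (hf : DifferentiableOn ℂ f (ball 0 R)) (hf0 : ∀ z ∈ ball (0 : ℂ) R, f z ≠ 0)
    (hM : ∀ z ∈ ball (0 : ℂ) R, ‖f z‖ ≤ M) (hlt : ‖f 0‖ < M) {z : ℂ} (hz : ‖z‖ < R) :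
    ‖f z‖ ≤ M * Real.exp (-((R - ‖z‖) / (R + ‖z‖) * Real.log (M / ‖f 0‖))) := by
  have hR : 0 < R := (norm_nonneg z).trans_lt hz
  have h0 : (0 : ℂ) ∈ ball (0 : ℂ) R := mem_ball_self hR
  have hpos : 0 < ‖f 0‖ := norm_pos_iff.2 (hf0 0 h0)
  have hMpos : 0 < M := hpos.trans hlt
  obtain ⟨L, hL, hL0, hLf⟩ := exists_differentiableOn_exp_eq (hf.div_const (f 0))
    (fun z hz => div_ne_zero (hf0 z hz) (hf0 0 h0)) (a := 0)
    (by rw [Complex.exp_zero, div_self (hf0 0 h0)])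
  set A := Real.log (M / ‖f 0‖) with hA
  have hApos : 0 < A := Real.log_pos ((one_lt_div hpos).2 hlt)
  have hnorm : ∀ w ∈ ball (0 : ℂ) R, Real.exp (L w).re = ‖f w‖ / ‖f 0‖ := by
    intro w hw
    rw [← Complex.norm_exp, hLf w hw, norm_div]
  have hre : ∀ w ∈ ball (0 : ℂ) R, (L w).re ≤ A := by
    intro w hw
    rw [hA, Real.le_log_iff_exp_le (by positivity), hnorm w hw]
    gcongr
    exact hM w hw
  have hden : ∀ w ∈ ball (0 : ℂ) R, 2 * (A : ℂ) - L w ≠ 0 := by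
    intro w hw h
    have h1 := congrArg Complex.re h
    simp at h1
    linarith [hre w hw]
  have hq : ‖L z / (2 * A - L z)‖ ≤ ‖z‖ / R := by
    have hmaps : MapsTo (fun w => L w / (2 * A - L w)) (ball 0 R)
        (closedBall (L 0 / (2 * A - L 0)) 1) := by
      intro w hw
      rw [hL0, zero_div, mem_closedBall_zero_iff, norm_div,
        div_le_one (norm_pos_iff.2 (hden w hw)), ← sq_le_sq₀ (norm_nonneg _) (norm_nonneg _),
        Complex.sq_norm, Complex.sq_norm, Complex.normSq_apply, Complex.normSq_apply]
      simp
      nlinarith [hre w hw]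
    have := Complex.dist_le_div_mul_dist_of_mapsTo_ball (f := fun w => L w / (2 * A - L w))
      (hL.div (hL.const_sub _) hden) hmaps (mem_ball_zero_iff.2 hz)
    simpa [hL0, div_eq_inv_mul] using this
  have hzb : z ∈ ball (0 : ℂ) R := mem_ball_zero_iff.2 hz
  have hReL : (R + ‖z‖) * (L z).re ≤ A * (2 * ‖z‖) := by
    rw [norm_div, div_le_div_iff₀ (norm_pos_iff.2 (hden z hzb)) hR,
      ← sq_le_sq₀ (by positivity) (by positivity), mul_pow, mul_pow,
      Complex.sq_norm, Complex.sq_norm (2 * (A : ℂ) - L z), Complex.normSq_apply,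
      Complex.normSq_apply] at hq
    simp at hq
    have hx := hre z hzb
    have h1 : ((L z).re * R) ^ 2 ≤ (‖z‖ * (2 * A - (L z).re)) ^ 2 := by
      have h2 : ‖z‖ ^ 2 * (L z).im ^ 2 ≤ R ^ 2 * (L z).im ^ 2 := by gcongr
      nlinarith
    have h3 := abs_le_of_sq_le_sq h1 (mul_nonneg (norm_nonneg z) (by linarith))
    linarith [(le_abs_self _).trans h3]
  have hfz : ‖f z‖ = ‖f 0‖ * Real.exp (L z).re := by
    rw [hnorm z hzb]
    field_simp
  have hM' : M = ‖f 0‖ * Real.exp A := by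
    rw [hA, Real.exp_log (by positivity)]
    field_simp
  rw [hfz, hM', mul_assoc, ← Real.exp_add]
  gcongr
  have hs : 0 < R + ‖z‖ := by positivity
  rw [← sub_nonneg]
  have : A + -((R - ‖z‖) / (R + ‖z‖) * A) - (L z).re =
      (A * (2 * ‖z‖) - (R + ‖z‖) * (L z).re) / (R + ‖z‖) := by
    field_simp
    ring
  rw [this]
  exact div_nonneg (by linarith) hs.le

/-- Holomorphic functions on the unit disk omitting `0` and `1` which are small at the center are
uniformly small on compact subsets. -/
theorem exists_norm_lt_of_omits_zero_one {r ε : ℝ} (hr : r < 1) (hε : 0 < ε) :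
    ∃ δ > 0, ∀ f : ℂ → ℂ, DifferentiableOn ℂ f (ball 0 1) → (∀ z ∈ ball (0 : ℂ) 1, f z ≠ 0) →
      (∀ z ∈ ball (0 : ℂ) 1, f z ≠ 1) → ‖f 0‖ < δ → ∀ z : ℂ, ‖z‖ ≤ r → ‖f z‖ < ε := by
  wlog hr0 : 0 ≤ r generalizing r
  · exact ⟨1, one_pos, fun f _ _ _ _ z hz => absurd ((norm_nonneg z).trans hz) hr0⟩
  obtain ⟨R, hrR, hR⟩ := exists_between hr
  obtain ⟨M', hM'⟩ := exists_norm_le_of_omits_zero_one hR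
  set M := max M' 1 with hMdef
  have hM1 : 1 ≤ M := le_max_right _ _
  have hMpos : 0 < M := by linarith
  have hκ : 0 < (R - r) / (R + r) := div_pos (by linarith) (by linarith)
  set κ := (R - r) / (R + r) with hκdef
  have hlim : Tendsto (fun A : ℝ => M * Real.exp (-(κ * A))) atTop (𝓝 (M * 0)) :=
    ((Real.tendsto_exp_atBot.comp
      (tendsto_neg_atTop_atBot.comp (tendsto_id.const_mul_atTop hκ)))).const_mul M
  rw [mul_zero] at hlim
  obtain ⟨A₀, hA₀⟩ := (hlim.eventually (gt_mem_nhds hε)).exists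
  refine ⟨min (1 / 2) (M * Real.exp (-A₀)), by positivity, ?_⟩
  intro f hf hf0 hf1 hsmall z hz
  have h1 : ‖f 0‖ < 1 / 2 := hsmall.trans_le (min_le_left _ _)
  have h2 : ‖f 0‖ < M * Real.exp (-A₀) := hsmall.trans_le (min_le_right _ _)
  have hpos : 0 < ‖f 0‖ := norm_pos_iff.2 (hf0 0 (mem_ball_self one_pos))
  have hsub : ball (0 : ℂ) R ⊆ ball 0 1 := ball_subset_ball hR.le
  have hb := norm_le_of_nonvanishing_of_norm_le (M := M) (hf.mono hsub)
    (fun w hw => hf0 w (hsub hw))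
    (fun w hw => (hM' f hf hf0 hf1 h1.le w (mem_ball_zero_iff.1 hw).le).trans (le_max_left _ _))
    (by linarith) (hz.trans_lt hrR)
  refine hb.trans_lt (lt_of_le_of_lt ?_ hA₀)
  gcongr ?_ * Real.exp (-?_)
  have hA : A₀ ≤ Real.log (M / ‖f 0‖) := by
    rw [Real.le_log_iff_exp_le (by positivity), le_div_iff₀ hpos]
    rw [Real.exp_neg, ← div_eq_mul_inv, lt_div_iff₀ (Real.exp_pos _)] at h2
    linarith
  have hκ' : κ ≤ (R - ‖z‖) / (R + ‖z‖) := by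
    have := norm_nonneg z
    rw [hκdef]
    have hRz : 0 < R + ‖z‖ := by linarith
    gcongr
    linarith
  have hlog : 0 ≤ Real.log (M / ‖f 0‖) := Real.log_nonneg ((one_le_div hpos).2 (by linarith))
  calc κ * A₀ ≤ κ * Real.log (M / ‖f 0‖) := by gcongr
    _ ≤ _ := by gcongr

/-- A holomorphic motion is jointly continuous on `Δ × E`. -/
theorem holomorphicMotion_jointly_continuous (E : Set ℂ) (h : ℂ → ℂ → ℂ)
    (hh : IsHolomorphicMotion E h) :
    ContinuousOn (fun p : ℂ × ℂ => h p.1 p.2) (Metric.ball (0 : ℂ) 1 ×ˢ E) := by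
  obtain ⟨hbase, hinj, hhol⟩ := hh
  rintro ⟨c₀, z₀⟩ ⟨hc₀, hz₀⟩
  simp only at hc₀ hz₀
  have hfst : ∀ z ∈ E, Tendsto (fun p : ℂ × ℂ => h p.1 z)
      (𝓝[ball (0 : ℂ) 1 ×ˢ E] (c₀, z₀)) (𝓝 (h c₀ z)) := by
    intro z hz
    have h1 : Tendsto (fun p : ℂ × ℂ => p.1) (𝓝[ball (0 : ℂ) 1 ×ˢ E] (c₀, z₀)) (𝓝 c₀) :=
      continuous_fst.continuousWithinAt
    exact ((hhol z hz).differentiableAt (isOpen_ball.mem_nhds hc₀)).continuousAt.tendsto.comp h1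
  by_cases hE : ∃ w ∈ E, w ≠ z₀
  swap
  · push Not at hE
    refine (hfst z₀ hz₀).congr' ?_
    filter_upwards [self_mem_nhdsWithin] with p hp
    rw [hE p.2 hp.2]
  obtain ⟨w, hw, hwz⟩ := hE
  have hne : ∀ c ∈ ball (0 : ℂ) 1, ∀ z ∈ E, ∀ z' ∈ E, z ≠ z' → h c z - h c z' ≠ 0 :=
    fun c hc z hz z' hz' hzz' => sub_ne_zero.2 fun he => hzz' (hinj c hc hz hz' he)
  have h0 : (0 : ℂ) ∈ ball (0 : ℂ) 1 := mem_ball_self one_pos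
  have hquot : Tendsto (fun p : ℂ × ℂ => (h p.1 p.2 - h p.1 z₀) / (h p.1 w - h p.1 z₀))
      (𝓝[ball (0 : ℂ) 1 ×ˢ E] (c₀, z₀)) (𝓝 0) := by
    rw [Metric.tendsto_nhds]
    intro ε hε
    obtain ⟨r, hcr, hr⟩ := exists_between (mem_ball_zero_iff.1 hc₀)
    obtain ⟨δ, hδ, hsmall⟩ := exists_norm_lt_of_omits_zero_one hr hε
    have hev1 : ∀ᶠ p : ℂ × ℂ in 𝓝 (c₀, z₀), ‖p.1‖ < r :=
      (continuous_fst.norm.continuousAt (x := (c₀, z₀))).eventually (gt_mem_nhds hcr)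
    have hev2 : ∀ᶠ p : ℂ × ℂ in 𝓝 (c₀, z₀), p.2 ≠ w :=
      (continuous_snd.continuousAt (x := (c₀, z₀))).eventually (isOpen_ne.mem_nhds hwz.symm)
    have hev3 : ∀ᶠ p : ℂ × ℂ in 𝓝 (c₀, z₀), ‖(p.2 - z₀) / (w - z₀)‖ < δ := by
      have hcont : Continuous fun p : ℂ × ℂ => ‖(p.2 - z₀) / (w - z₀)‖ := by fun_prop
      exact (hcont.continuousAt (x := (c₀, z₀))).eventually (gt_mem_nhds (by simpa using hδ))
    filter_upwards [self_mem_nhdsWithin, mem_nhdsWithin_of_mem_nhds hev1,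
      mem_nhdsWithin_of_mem_nhds hev2, mem_nhdsWithin_of_mem_nhds hev3]
    rintro ⟨c, z⟩ ⟨hc, hz⟩ h1 h2 h3
    simp only at hc hz h1 h2 h3 ⊢
    rw [dist_zero_right]
    rcases eq_or_ne z z₀ with rfl | hzz
    · simpa using hε
    refine hsmall (fun c => (h c z - h c z₀) / (h c w - h c z₀))
      (((hhol z hz).sub (hhol z₀ hz₀)).div ((hhol w hw).sub (hhol z₀ hz₀))
        fun c hc => hne c hc w hw z₀ hz₀ hwz)
      (fun c hc => div_ne_zero (hne c hc z hz z₀ hz₀ hzz) (hne c hc w hw z₀ hz₀ hwz))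
      (fun c hc heq => ?_) (by simpa only [hbase z hz, hbase z₀ hz₀, hbase w hw] using h3) c h1.le
    rw [div_eq_one_iff_eq (hne c hc w hw z₀ hz₀ hwz)] at heq
    exact hne c hc z hz w hw h2 (by linear_combination heq)
  have hlim := (hquot.mul ((hfst w hw).sub (hfst z₀ hz₀))).add (hfst z₀ hz₀)
  rw [zero_mul, zero_add] at hlim
  refine hlim.congr' ?_
  filter_upwards [self_mem_nhdsWithin] with p hp
  rw [div_mul_cancel₀ _ (hne p.1 hp.1 w hw z₀ hz₀ hwz), sub_add_cancel]
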